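/- Let n ≥ 2 be an integer and let d₁, d₂, d₃ be positive integers with d₁, d₂, d₃ ≤ n+1 and d₁ + d₂ + d₃ ≥ n + 1. Then the polytope T(n,d₁,d₂,d₃) ⊆ ℝ³ equals the convex hull of the ten points (0,0,0), ((n+1)(d₁-1)/(n d₁),0,0), (0,(n+1)(d₂-1)/(n d₂),0), (0,0,(n+1)(d₃-1)/(n d₃)), A₁, B₁, A₂, B₂, A₃, B₃, where: if d₂+d₃ ≥ n+1 then A₁ = (0, 1, (n+1-d₂)/d₃) and B₁ = (0, (n+1-d₃)/d₂, 1), while if d₂+d₃ ≤ n+1 then A₁ = (0, (d₃-1+n(d₂-1))/((n-1)d₂), (d₂-1+n(d₃-1))/((n-1)d₃)) and B₁ = ((n+1-(d₂+d₃))/d₁, 1, 1); if d₁+d₃ ≥ n+1 then A₂ = (1, 0, (n+1-d₁)/d₃) and B₂ = ((n+1-d₃)/d₁, 0, 1), while if d₁+d₃ ≤ n+1 then A₂ = ((d₃-1+n(d₁-1))/((n-1)d₁), 0, (d₁-1+n(d₃-1))/((n-1)d₃)) and B₂ = (1, (n+1-(d₁+d₃))/d₂, 1); if d₁+d₂ ≥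 n+1 then A₃ = (1, (n+1-d₁)/d₂, 0) and B₃ = ((n+1-d₂)/d₁, 1, 0), while if d₁+d₂ ≤ n+1 then A₃ = ((d₂-1+n(d₁-1))/((n-1)d₁), (d₁-1+n(d₂-1))/((n-1)d₂), 0) and B₃ = (1, 1, (n+1-(d₁+d₂))/d₃). (In the boundary cases where a pairwise sum equals n+1, the two descriptions of A_i, B_i agree.) -/

import Mathlib

/-- An affine function of `ε` that is nonnegative at `0`, and constant if it vanishes there,
is nonnegative near `0`. -/
lemma eventually_affine_nonneg {a b : ℝ} (ha : 0 ≤ a) (hab : a = 0 → b = 0) :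
    ∀ᶠ ε in nhds (0 : ℝ), 0 ≤ a + ε * b := by
  rcases ha.eq_or_lt with h | h
  · simp [← h, hab h.symm]
  · have hc : Continuous fun ε : ℝ => a + ε * b := by fun_prop
    filter_upwards [hc.continuousAt.eventually_const_lt
      (show 0 < a + 0 * b by simpa using h)] with ε hε
    exact hε.le

/-- The polytope `T(n,d₁,d₂,d₃)` in terms of the rescaled coordinates `dᵢ xᵢ`, without redundant
inequalities. -/
def reducedPolytope (n d₁ d₂ d₃ : ℝ) : Set (ℝ × ℝ × ℝ) :=
  {p | 0 ≤ d₁ * p.1 ∧ 0 ≤ d₂ * p.2.1 ∧ 0 ≤ d₃ * p.2.2 ∧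
    0 ≤ n + 1 - (d₁ * p.1 + d₂ * p.2.1 + d₃ * p.2.2) ∧
    0 ≤ (n + 1) * (d₁ - 1) + (d₁ * p.1 + d₂ * p.2.1 + d₃ * p.2.2) - (n + 1) * (d₁ * p.1) ∧
    0 ≤ (n + 1) * (d₂ - 1) + (d₁ * p.1 + d₂ * p.2.1 + d₃ * p.2.2) - (n + 1) * (d₂ * p.2.1) ∧
    0 ≤ (n + 1) * (d₃ - 1) + (d₁ * p.1 + d₂ * p.2.1 + d₃ * p.2.2) - (n + 1) * (d₃ * p.2.2)}

lemma coord_le_of_slack_nonneg {n d u S : ℝ} (hn : 0 < n + 1) (hS : 0 ≤ n + 1 - S)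
    (h : 0 ≤ (n + 1) * (d - 1) + S - (n + 1) * u) : u ≤ d := by
  by_contra! hlt
  nlinarith [mul_pos hn (sub_pos.2 hlt)]

lemma isCompact_reducedPolytope {n d₁ d₂ d₃ : ℝ} (hn : 0 < n + 1)
    (hd₁ : 0 < d₁) (hd₂ : 0 < d₂) (hd₃ : 0 < d₃) :
    IsCompact (reducedPolytope n d₁ d₂ d₃) := by
  refine (isCompact_Icc (a := ((0, 0, 0) : ℝ × ℝ × ℝ)) (b := (1, 1, 1))).of_isClosed_subset ?_ ?_
  · simp only [reducedPolytope, Set.ofPred_and]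
    repeat' apply IsClosed.inter
    all_goals exact isClosed_le (by fun_prop) (by fun_prop)
  · rintro ⟨x, y, z⟩ ⟨h1, h2, h3, h4, h5, h6, h7⟩
    dsimp only at *
    have k1 := coord_le_of_slack_nonneg hn h4 h5
    have k2 := coord_le_of_slack_nonneg hn h4 h6
    have k3 := coord_le_of_slack_nonneg hn h4 h7
    refine ⟨⟨?_, ?_, ?_⟩, ?_, ?_, ?_⟩ <;> dsimp only
    · exact nonneg_of_mul_nonneg_right h1 hd₁
    · exact nonneg_of_mul_nonneg_right h2 hd₂
    · exact nonneg_of_mul_nonneg_right h3 hd₃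
    · nlinarith
    · nlinarith
    · nlinarith

lemma convex_reducedPolytope (n d₁ d₂ d₃ : ℝ) : Convex ℝ (reducedPolytope n d₁ d₂ d₃) := by
  rintro ⟨x, y, z⟩ ⟨h1, h2, h3, h4, h5, h6, h7⟩ ⟨x', y', z'⟩ ⟨k1, k2, k3, k4, k5, k6, k7⟩ a b ha hb
    hab
  obtain rfl : b = 1 - a := by linarith
  simp only [reducedPolytope, Set.mem_ofPred_eq, Prod.smul_mk, Prod.mk_add_mk, smul_eq_mul] at *
  refine ⟨?_, ?_, ?_, ?_, ?_, ?_, ?_⟩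
  · linarith [mul_nonneg ha h1, mul_nonneg hb k1]
  · linarith [mul_nonneg ha h2, mul_nonneg hb k2]
  · linarith [mul_nonneg ha h3, mul_nonneg hb k3]
  · linarith [mul_nonneg ha h4, mul_nonneg hb k4]
  · linarith [mul_nonneg ha h5, mul_nonneg hb k5]
  · linarith [mul_nonneg ha h6, mul_nonneg hb k6]
  · linarith [mul_nonneg ha h7, mul_nonneg hb k7]

/-- A direction along which every active constraint is constant vanishes at an extreme point. -/
lemma direction_eq_zero_of_mem_extremePoints {n d₁ d₂ d₃ x y z : ℝ}
    (hd₁ : 0 < d₁) (hd₂ : 0 < d₂) (hd₃ : 0 < d₃)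
    (hp : (x, y, z) ∈ (reducedPolytope n d₁ d₂ d₃).extremePoints ℝ) (v₁ v₂ v₃ : ℝ)
    (h₁ : d₁ * x = 0 → v₁ = 0) (h₂ : d₂ * y = 0 → v₂ = 0) (h₃ : d₃ * z = 0 → v₃ = 0)
    (hS : d₁ * x + d₂ * y + d₃ * z = n + 1 → v₁ + v₂ + v₃ = 0)
    (ht₁ : (n + 1) * (d₁ * x) = (n + 1) * (d₁ - 1) + (d₁ * x + d₂ * y + d₃ * z) →
      (n + 1) * v₁ = v₁ + v₂ + v₃)
    (ht₂ : (n + 1) * (d₂ * y) = (n + 1) * (d₂ - 1) + (d₁ * x + d₂ * y + d₃ * z) →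
      (n + 1) * v₂ = v₁ + v₂ + v₃)
    (ht₃ : (n + 1) * (d₃ * z) = (n + 1) * (d₃ - 1) + (d₁ * x + d₂ * y + d₃ * z) →
      (n + 1) * v₃ = v₁ + v₂ + v₃) :
    v₁ = 0 ∧ v₂ = 0 ∧ v₃ = 0 := by
  obtain ⟨⟨c1, c2, c3, c4, c5, c6, c7⟩, hext⟩ := hp
  dsimp only at c1 c2 c3 c4 c5 c6 c7
  have key : ∀ᶠ ε in nhds (0 : ℝ),
      (x + ε * (v₁ / d₁), y + ε * (v₂ / d₂), z + ε * (v₃ / d₃)) ∈ reducedPolytope n d₁ d₂ d₃ := by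
    filter_upwards [eventually_affine_nonneg c1 h₁, eventually_affine_nonneg c2 h₂,
      eventually_affine_nonneg c3 h₃,
      eventually_affine_nonneg (b := -(v₁ + v₂ + v₃)) c4 fun h => by linarith [hS (by linarith)],
      eventually_affine_nonneg (b := v₁ + v₂ + v₃ - (n + 1) * v₁) c5
        fun h => by linarith [ht₁ (by linarith)],
      eventually_affine_nonneg (b := v₁ + v₂ + v₃ - (n + 1) * v₂) c6
        fun h => by linarith [ht₂ (by linarith)],
      eventually_affine_nonneg (b := v₁ + v₂ + v₃ - (n + 1) * v₃) c7
        fun h => by linarith [ht₃ (by linarith)]] with ε e1 e2 e3 e4 e5 e6 e7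
    have m1 : d₁ * (x + ε * (v₁ / d₁)) = d₁ * x + ε * v₁ := by field_simp
    have m2 : d₂ * (y + ε * (v₂ / d₂)) = d₂ * y + ε * v₂ := by field_simp
    have m3 : d₃ * (z + ε * (v₃ / d₃)) = d₃ * z + ε * v₃ := by field_simp
    simp only [reducedPolytope, Set.mem_ofPred_eq, m1, m2, m3]
    refine ⟨e1, e2, e3, ?_, ?_, ?_, ?_⟩ <;> linarith
  have key' := (continuous_neg.tendsto' (0 : ℝ) 0 neg_zero).eventually key
  obtain ⟨ε, ⟨hε, hε'⟩, hpos⟩ :=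
    (((key.and key').filter_mono nhdsWithin_le_nhds).and
      (self_mem_nhdsWithin (a := (0 : ℝ)) (s := Set.Ioi 0))).exists
  have hpos : 0 < ε := hpos
  have hmid := hext hε hε' ⟨1 / 2, 1 / 2, by norm_num, by norm_num, by norm_num, by
    ext <;> simp <;> ring⟩
  simp only [Prod.mk.injEq, add_eq_left, mul_eq_zero, div_eq_zero_iff, hpos.ne', hd₁.ne', hd₂.ne',
    hd₃.ne', false_or, or_false] at hmid
  exact hmid

/-- Classification of the vertices on the face `u₁ + u₂ + u₃ = n + 1`, in the rescaled
coordinates `uᵢ = dᵢ xᵢ`. -/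
lemma vertex_classification_of_sum_eq {n d₁ d₂ d₃ u₁ u₂ u₃ : ℝ} (hn : 2 ≤ n)
    (hd₁' : d₁ ≤ n + 1) (hd₂' : d₂ ≤ n + 1) (hd₃' : d₃ ≤ n + 1)
    (h₁ : 0 ≤ u₁) (h₂ : 0 ≤ u₂) (h₃ : 0 ≤ u₃) (hS : 0 ≤ n + 1 - (u₁ + u₂ + u₃))
    (ht₁ : 0 ≤ (n + 1) * (d₁ - 1) + (u₁ + u₂ + u₃) - (n + 1) * u₁)
    (ht₂ : 0 ≤ (n + 1) * (d₂ - 1) + (u₁ + u₂ + u₃) - (n + 1) * u₂)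
    (ht₃ : 0 ≤ (n + 1) * (d₃ - 1) + (u₁ + u₂ + u₃) - (n + 1) * u₃)
    (hext : ∀ v₁ v₂ v₃ : ℝ, (u₁ = 0 → v₁ = 0) → (u₂ = 0 → v₂ = 0) → (u₃ = 0 → v₃ = 0) →
      (u₁ + u₂ + u₃ = n + 1 → v₁ + v₂ + v₃ = 0) →
      ((n + 1) * u₁ = (n + 1) * (d₁ - 1) + (u₁ + u₂ + u₃) → (n + 1) * v₁ = v₁ + v₂ + v₃) →
      ((n + 1) * u₂ = (n + 1) * (d₂ - 1) + (u₁ + u₂ + u₃) → (n + 1) * v₂ = v₁ + v₂ + v₃) →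
      ((n + 1) * u₃ = (n + 1) * (d₃ - 1) + (u₁ + u₂ + u₃) → (n + 1) * v₃ = v₁ + v₂ + v₃) →
      v₁ = 0 ∧ v₂ = 0 ∧ v₃ = 0)
    (hfull : u₁ + u₂ + u₃ = n + 1) :
    (n + 1 ≤ d₂ + d₃ ∧ u₁ = 0 ∧ u₂ = d₂ ∧ u₃ = n + 1 - d₂) ∨
    (n + 1 ≤ d₂ + d₃ ∧ u₁ = 0 ∧ u₂ = n + 1 - d₃ ∧ u₃ = d₃) ∨
    (n + 1 ≤ d₁ + d₃ ∧ u₁ = d₁ ∧ u₂ = 0 ∧ u₃ = n + 1 - d₁) ∨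
    (n + 1 ≤ d₁ + d₃ ∧ u₁ = n + 1 - d₃ ∧ u₂ = 0 ∧ u₃ = d₃) ∨
    (n + 1 ≤ d₁ + d₂ ∧ u₁ = d₁ ∧ u₂ = n + 1 - d₁ ∧ u₃ = 0) ∨
    (n + 1 ≤ d₁ + d₂ ∧ u₁ = n + 1 - d₂ ∧ u₂ = d₂ ∧ u₃ = 0) ∨
    (d₂ + d₃ ≤ n + 1 ∧ u₁ = n + 1 - (d₂ + d₃) ∧ u₂ = d₂ ∧ u₃ = d₃) ∨
    (d₁ + d₃ ≤ n + 1 ∧ u₁ = d₁ ∧ u₂ = n + 1 - (d₁ + d₃) ∧ u₃ = d₃) ∨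
    (d₁ + d₂ ≤ n + 1 ∧ u₁ = d₁ ∧ u₂ = d₂ ∧ u₃ = n + 1 - (d₁ + d₂)) := by
  have hN : 0 < n + 1 := by linarith
  have k₁ := coord_le_of_slack_nonneg hN hS ht₁
  have k₂ := coord_le_of_slack_nonneg hN hS ht₂
  have k₃ := coord_le_of_slack_nonneg hN hS ht₃
  have tight : ∀ {u d : ℝ}, (n + 1) * u = (n + 1) * (d - 1) + (u₁ + u₂ + u₃) → u = d :=
    fun {u d} h => mul_left_cancel₀ hN.ne' (by rw [h, hfull]; ring)
  have p₁₂ : (u₁ = 0 ∨ u₁ = d₁) ∨ (u₂ = 0 ∨ u₂ = d₂) := by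
    by_contra! h
    obtain ⟨⟨a, b⟩, c, d⟩ := h
    simpa using (hext 1 (-1) 0 (absurd · a) (absurd · c) (fun _ => rfl) (fun _ => by norm_num)
      (fun h => absurd (tight h) b) (fun h => absurd (tight h) d) (fun _ => by norm_num)).1
  have p₁₃ : (u₁ = 0 ∨ u₁ = d₁) ∨ (u₃ = 0 ∨ u₃ = d₃) := by
    by_contra! h
    obtain ⟨⟨a, b⟩, c, d⟩ := h
    simpa using (hext 1 0 (-1) (absurd · a) (fun _ => rfl) (absurd · c) (fun _ => by norm_num)
      (fun h => absurd (tight h) b) (fun _ => by norm_num) (fun h => absurd (tight h) d)).1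
  have p₂₃ : (u₂ = 0 ∨ u₂ = d₂) ∨ (u₃ = 0 ∨ u₃ = d₃) := by
    by_contra! h
    obtain ⟨⟨a, b⟩, c, d⟩ := h
    simpa using (hext 0 1 (-1) (fun _ => rfl) (absurd · a) (absurd · c) (fun _ => by norm_num)
      (fun _ => by norm_num) (fun h => absurd (tight h) b) (fun h => absurd (tight h) d)).2.1
  have hpair : ((u₁ = 0 ∨ u₁ = d₁) ∧ (u₂ = 0 ∨ u₂ = d₂)) ∨
      ((u₁ = 0 ∨ u₁ = d₁) ∧ (u₃ = 0 ∨ u₃ = d₃)) ∨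
      ((u₂ = 0 ∨ u₂ = d₂) ∧ (u₃ = 0 ∨ u₃ = d₃)) := by
    rcases p₁₂ with a | b
    · exact p₂₃.imp (fun c => ⟨a, c⟩) fun c => .inl ⟨a, c⟩
    · exact p₁₃.elim (fun c => .inl ⟨c, b⟩) fun c => .inr (.inr ⟨b, c⟩)
  clear hext p₁₂ p₁₃ p₂₃ ht₁ ht₂ ht₃ tight
  rcases hpair with ⟨a | a, b | b⟩ | ⟨a | a, b | b⟩ | ⟨a | a, b | b⟩
  · iterate 3 right
    left
    refine ⟨?_, ?_, ?_, ?_⟩ <;> linarith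
  · left
    refine ⟨?_, ?_, ?_, ?_⟩ <;> linarith
  · iterate 2 right
    left
    refine ⟨?_, ?_, ?_, ?_⟩ <;> linarith
  · iterate 8 right
    refine ⟨?_, ?_, ?_, ?_⟩ <;> linarith
  · iterate 5 right
    left
    refine ⟨?_, ?_, ?_, ?_⟩ <;> linarith
  · right
    left
    refine ⟨?_, ?_, ?_, ?_⟩ <;> linarith
  · iterate 4 right
    left
    refine ⟨?_, ?_, ?_, ?_⟩ <;> linarith
  · iterate 7 right
    left
    refine ⟨?_, ?_, ?_, ?_⟩ <;> linarith
  · iterate 4 right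
    left
    refine ⟨?_, ?_, ?_, ?_⟩ <;> linarith
  · iterate 3 right
    left
    refine ⟨?_, ?_, ?_, ?_⟩ <;> linarith
  · iterate 5 right
    left
    refine ⟨?_, ?_, ?_, ?_⟩ <;> linarith
  · iterate 6 right
    left
    refine ⟨?_, ?_, ?_, ?_⟩ <;> linarith

/-- Classification of the vertices off the face `u₁ + u₂ + u₃ = n + 1`, in the rescaled
coordinates `uᵢ = dᵢ xᵢ`. -/
lemma vertex_classification_of_sum_ne {n d₁ d₂ d₃ u₁ u₂ u₃ : ℝ} (hn : 2 ≤ n)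
    (hd₁ : 1 ≤ d₁) (hd₂ : 1 ≤ d₂) (hd₃ : 1 ≤ d₃) (hsum : n + 1 ≤ d₁ + d₂ + d₃)
    (h₁ : 0 ≤ u₁) (h₂ : 0 ≤ u₂) (h₃ : 0 ≤ u₃) (hS : 0 ≤ n + 1 - (u₁ + u₂ + u₃))
    (ht₁ : 0 ≤ (n + 1) * (d₁ - 1) + (u₁ + u₂ + u₃) - (n + 1) * u₁)
    (ht₂ : 0 ≤ (n + 1) * (d₂ - 1) + (u₁ + u₂ + u₃) - (n + 1) * u₂)
    (ht₃ : 0 ≤ (n + 1) * (d₃ - 1) + (u₁ + u₂ + u₃) - (n + 1) * u₃)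
    (hext : ∀ v₁ v₂ v₃ : ℝ, (u₁ = 0 → v₁ = 0) → (u₂ = 0 → v₂ = 0) → (u₃ = 0 → v₃ = 0) →
      (u₁ + u₂ + u₃ = n + 1 → v₁ + v₂ + v₃ = 0) →
      ((n + 1) * u₁ = (n + 1) * (d₁ - 1) + (u₁ + u₂ + u₃) → (n + 1) * v₁ = v₁ + v₂ + v₃) →
      ((n + 1) * u₂ = (n + 1) * (d₂ - 1) + (u₁ + u₂ + u₃) → (n + 1) * v₂ = v₁ + v₂ + v₃) →
      ((n + 1) * u₃ = (n + 1) * (d₃ - 1) + (u₁ + u₂ + u₃) → (n + 1) * v₃ = v₁ + v₂ + v₃) →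
      v₁ = 0 ∧ v₂ = 0 ∧ v₃ = 0)
    (hfull : u₁ + u₂ + u₃ ≠ n + 1) :
    (u₁ = 0 ∧ u₂ = 0 ∧ u₃ = 0) ∨
    (n * u₁ = (n + 1) * (d₁ - 1) ∧ u₂ = 0 ∧ u₃ = 0) ∨
    (u₁ = 0 ∧ n * u₂ = (n + 1) * (d₂ - 1) ∧ u₃ = 0) ∨
    (u₁ = 0 ∧ u₂ = 0 ∧ n * u₃ = (n + 1) * (d₃ - 1)) ∨
    (d₂ + d₃ < n + 1 ∧ u₁ = 0 ∧ (n - 1) * u₂ = d₃ - 1 + n * (d₂ - 1) ∧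
      (n - 1) * u₃ = d₂ - 1 + n * (d₃ - 1)) ∨
    (d₁ + d₃ < n + 1 ∧ (n - 1) * u₁ = d₃ - 1 + n * (d₁ - 1) ∧ u₂ = 0 ∧
      (n - 1) * u₃ = d₁ - 1 + n * (d₃ - 1)) ∨
    (d₁ + d₂ < n + 1 ∧ (n - 1) * u₁ = d₂ - 1 + n * (d₁ - 1) ∧
      (n - 1) * u₂ = d₁ - 1 + n * (d₂ - 1) ∧ u₃ = 0) := by
  have hN : 0 < n + 1 := by linarith
  have hlt : u₁ + u₂ + u₃ < n + 1 := lt_of_le_of_ne (by linarith) hfull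
  rcases (add_nonneg (add_nonneg h₁ h₂) h₃).eq_or_lt with h0 | hpos
  · left
    refine ⟨?_, ?_, ?_⟩ <;> linarith
  have not_both : ∀ {u d : ℝ}, 1 ≤ d →
      (n + 1) * u = (n + 1) * (d - 1) + (u₁ + u₂ + u₃) → u ≠ 0 := by
    rintro u d hd h rfl
    nlinarith [mul_nonneg hN.le (sub_nonneg.2 hd)]
  have q₁ : u₁ = 0 ∨ (n + 1) * u₁ = (n + 1) * (d₁ - 1) + (u₁ + u₂ + u₃) := by
    by_contra! hfree
    obtain ⟨a, b⟩ := hfree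
    by_cases hj : (n + 1) * u₂ = (n + 1) * (d₂ - 1) + (u₁ + u₂ + u₃) <;>
      by_cases hk : (n + 1) * u₃ = (n + 1) * (d₃ - 1) + (u₁ + u₂ + u₃)
    · have h := (hext (n - 1) 1 1 (absurd · a) (absurd · (not_both hd₂ hj)) (absurd · (not_both hd₃ hk))
        (absurd · hfull) (absurd · b) (fun _ => by ring) (fun _ => by ring)).1
      linarith
    · have h := (hext n 1 0 (absurd · a) (absurd · (not_both hd₂ hj)) (fun _ => rfl)
        (absurd · hfull) (absurd · b) (fun _ => by ring) (absurd · hk)).1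
      linarith
    · have h := (hext n 0 1 (absurd · a) (fun _ => rfl) (absurd · (not_both hd₃ hk))
        (absurd · hfull) (absurd · b) (absurd · hj) (fun _ => by ring)).1
      linarith
    · have h := (hext 1 0 0 (absurd · a) (fun _ => rfl) (fun _ => rfl)
        (absurd · hfull) (absurd · b) (absurd · hj) (absurd · hk)).1
      linarith
  have q₂ : u₂ = 0 ∨ (n + 1) * u₂ = (n + 1) * (d₂ - 1) + (u₁ + u₂ + u₃) := by
    by_contra! hfree
    obtain ⟨a, b⟩ := hfree
    by_cases hj : (n + 1) * u₁ = (n + 1) * (d₁ - 1) + (u₁ + u₂ + u₃) <;>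
      by_cases hk : (n + 1) * u₃ = (n + 1) * (d₃ - 1) + (u₁ + u₂ + u₃)
    · have h := (hext 1 (n - 1) 1 (absurd · (not_both hd₁ hj)) (absurd · a) (absurd · (not_both hd₃ hk))
        (absurd · hfull) (fun _ => by ring) (absurd · b) (fun _ => by ring)).2.1
      linarith
    · have h := (hext 1 n 0 (absurd · (not_both hd₁ hj)) (absurd · a) (fun _ => rfl)
        (absurd · hfull) (fun _ => by ring) (absurd · b) (absurd · hk)).2.1
      linarith
    · have h := (hext 0 n 1 (fun _ => rfl) (absurd · a) (absurd · (not_both hd₃ hk))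
        (absurd · hfull) (absurd · hj) (absurd · b) (fun _ => by ring)).2.1
      linarith
    · have h := (hext 0 1 0 (fun _ => rfl) (absurd · a) (fun _ => rfl)
        (absurd · hfull) (absurd · hj) (absurd · b) (absurd · hk)).2.1
      linarith
  have q₃ : u₃ = 0 ∨ (n + 1) * u₃ = (n + 1) * (d₃ - 1) + (u₁ + u₂ + u₃) := by
    by_contra! hfree
    obtain ⟨a, b⟩ := hfree
    by_cases hj : (n + 1) * u₁ = (n + 1) * (d₁ - 1) + (u₁ + u₂ + u₃) <;>
      by_cases hk : (n + 1) * u₂ = (n + 1) * (d₂ - 1) + (u₁ + u₂ + u₃)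
    · have h := (hext 1 1 (n - 1) (absurd · (not_both hd₁ hj)) (absurd · (not_both hd₂ hk)) (absurd · a)
        (absurd · hfull) (fun _ => by ring) (fun _ => by ring) (absurd · b)).2.2
      linarith
    · have h := (hext 1 0 n (absurd · (not_both hd₁ hj)) (fun _ => rfl) (absurd · a)
        (absurd · hfull) (fun _ => by ring) (absurd · hk) (absurd · b)).2.2
      linarith
    · have h := (hext 0 1 n (fun _ => rfl) (absurd · (not_both hd₂ hk)) (absurd · a)
        (absurd · hfull) (absurd · hj) (fun _ => by ring) (absurd · b)).2.2
      linarith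
    · have h := (hext 0 0 1 (fun _ => rfl) (fun _ => rfl) (absurd · a)
        (absurd · hfull) (absurd · hj) (absurd · hk) (absurd · b)).2.2
      linarith
  rcases q₁ with a | a <;> rcases q₂ with b | b <;> rcases q₃ with c | c
  · linarith
  · iterate 3 right
    left
    refine ⟨a, b, ?_⟩
    linear_combination c + a + b
  · iterate 2 right
    left
    refine ⟨a, ?_, c⟩
    linear_combination b + a + c
  · iterate 4 right
    left
    have hlt' : d₂ + d₃ < n + 1 := by
      have : (n + 1) * (d₂ + d₃) < (n + 1) * (n + 1) := by nlinarith
      exact lt_of_mul_lt_mul_left this hN.le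
    refine ⟨hlt', a, mul_left_cancel₀ hN.ne' ?_, mul_left_cancel₀ hN.ne' ?_⟩
    · linear_combination n * b + c + (n + 1) * a
    · linear_combination n * c + b + (n + 1) * a
  · right
    left
    refine ⟨?_, b, c⟩
    linear_combination a + b + c
  · iterate 5 right
    left
    have hlt' : d₁ + d₃ < n + 1 := by
      have : (n + 1) * (d₁ + d₃) < (n + 1) * (n + 1) := by nlinarith
      exact lt_of_mul_lt_mul_left this hN.le
    refine ⟨hlt', mul_left_cancel₀ hN.ne' ?_, b, mul_left_cancel₀ hN.ne' ?_⟩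
    · linear_combination n * a + c + (n + 1) * b
    · linear_combination n * c + a + (n + 1) * b
  · iterate 6 right
    have hlt' : d₁ + d₂ < n + 1 := by
      have : (n + 1) * (d₁ + d₂) < (n + 1) * (n + 1) := by nlinarith
      exact lt_of_mul_lt_mul_left this hN.le
    refine ⟨hlt', mul_left_cancel₀ hN.ne' ?_, mul_left_cancel₀ hN.ne' ?_, c⟩
    · linear_combination n * a + b + (n + 1) * c
    · linear_combination n * b + a + (n + 1) * c
  · exfalso
    have hn2 : n = 2 := by
      by_contra hne
      have hgt : 2 < n := lt_of_le_of_ne hn (Ne.symm hne)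
      nlinarith [mul_pos (sub_pos.2 hgt) (sub_pos.2 hlt)]
    subst hn2
    simpa using (hext 1 1 1 (absurd · (not_both hd₁ a)) (absurd · (not_both hd₂ b))
      (absurd · (not_both hd₃ c)) (absurd · hfull) (fun _ => by norm_num) (fun _ => by norm_num)
      (fun _ => by norm_num)).1

lemma div_mem_reducedPolytope {n d₁ d₂ d₃ u₁ u₂ u₃ : ℝ}
    (hd₁ : 0 < d₁) (hd₂ : 0 < d₂) (hd₃ : 0 < d₃)
    (h₁ : 0 ≤ u₁) (h₂ : 0 ≤ u₂) (h₃ : 0 ≤ u₃) (hS : u₁ + u₂ + u₃ ≤ n + 1)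
    (ht₁ : (n + 1) * u₁ ≤ (n + 1) * (d₁ - 1) + (u₁ + u₂ + u₃))
    (ht₂ : (n + 1) * u₂ ≤ (n + 1) * (d₂ - 1) + (u₁ + u₂ + u₃))
    (ht₃ : (n + 1) * u₃ ≤ (n + 1) * (d₃ - 1) + (u₁ + u₂ + u₃)) :
    (u₁ / d₁, u₂ / d₂, u₃ / d₃) ∈ reducedPolytope n d₁ d₂ d₃ := by
  simp only [reducedPolytope, Set.mem_ofPred_eq, mul_div_cancel₀ _ hd₁.ne',
    mul_div_cancel₀ _ hd₂.ne', mul_div_cancel₀ _ hd₃.ne']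
  refine ⟨h₁, h₂, h₃, ?_, ?_, ?_, ?_⟩ <;> linarith

lemma div_mem_reducedPolytope_of_sum_eq {n d₁ d₂ d₃ u₁ u₂ u₃ : ℝ} (hn : 0 < n + 1)
    (hd₁ : 0 < d₁) (hd₂ : 0 < d₂) (hd₃ : 0 < d₃)
    (h₁ : 0 ≤ u₁) (h₂ : 0 ≤ u₂) (h₃ : 0 ≤ u₃) (hS : u₁ + u₂ + u₃ = n + 1)
    (ht₁ : u₁ ≤ d₁) (ht₂ : u₂ ≤ d₂) (ht₃ : u₃ ≤ d₃) :
    (u₁ / d₁, u₂ / d₂, u₃ / d₃) ∈ reducedPolytope n d₁ d₂ d₃ := by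
  apply div_mem_reducedPolytope hd₁ hd₂ hd₃ h₁ h₂ h₃ hS.le <;> rw [hS] <;> nlinarith

/-- The vertex on a coordinate axis. -/
lemma axis_vertex {n d : ℝ} (hn : 2 ≤ n) (hd : 1 ≤ d) (hd' : d ≤ n + 1) :
    0 ≤ (n + 1) * (d - 1) / n ∧ (n + 1) * (d - 1) / n ≤ n + 1 ∧
      (n + 1) * ((n + 1) * (d - 1) / n) = (n + 1) * (d - 1) + (n + 1) * (d - 1) / n := by
  have hn0 : 0 < n := by linarith
  refine ⟨div_nonneg (mul_nonneg (by linarith) (by linarith)) hn0.le, ?_, ?_⟩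
  · rw [div_le_iff₀ hn0]
    nlinarith
  · field_simp

/-- The vertex in a coordinate plane, away from the face `S = n + 1`. -/
lemma plane_vertex {n d e : ℝ} (hn : 2 ≤ n) (hd : 1 ≤ d) (he : 1 ≤ e) (hde : d + e ≤ n + 1) :
    0 ≤ (e - 1 + n * (d - 1)) / (n - 1) ∧ 0 ≤ (d - 1 + n * (e - 1)) / (n - 1) ∧
      (e - 1 + n * (d - 1)) / (n - 1) + (d - 1 + n * (e - 1)) / (n - 1) ≤ n + 1 ∧
      (n + 1) * ((e - 1 + n * (d - 1)) / (n - 1)) = (n + 1) * (d - 1) +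
        ((e - 1 + n * (d - 1)) / (n - 1) + (d - 1 + n * (e - 1)) / (n - 1)) ∧
      (n + 1) * ((d - 1 + n * (e - 1)) / (n - 1)) = (n + 1) * (e - 1) +
        ((e - 1 + n * (d - 1)) / (n - 1) + (d - 1 + n * (e - 1)) / (n - 1)) := by
  have hn1 : 0 < n - 1 := by linarith
  refine ⟨div_nonneg (by nlinarith) hn1.le, div_nonneg (by nlinarith) hn1.le, ?_, ?_, ?_⟩
  · rw [← add_div, div_le_iff₀ hn1]
    nlinarith
  · field_simp
    ring
  · field_simp
    ring

/-- Clearing denominators in one of the K-semistability inequalities. -/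
lemma slack_nonneg_iff {n d u v w a b : ℝ} (hn : 0 < n + 1) (hd : 0 < d) :
    0 ≤ (d - 1) / d - n * u / (n + 1) + a * v / (d * (n + 1)) + b * w / (d * (n + 1)) ↔
      0 ≤ (n + 1) * (d - 1) + (d * u + a * v + b * w) - (n + 1) * (d * u) := by
  have h : (d - 1) / d - n * u / (n + 1) + a * v / (d * (n + 1)) + b * w / (d * (n + 1)) =
      ((n + 1) * (d - 1) + (d * u + a * v + b * w) - (n + 1) * (d * u)) / (d * (n + 1)) := by
    field_simp
    ring
  rw [h, le_div_iff₀ (mul_pos hd hn), zero_mul]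


/-- The K-semistable domain `Kss(ℙⁿ, S_{d₁}+S_{d₂}+S_{d₃})` in the case
`d₁ + d₂ + d₃ ≥ n + 1`: the polytope `T(n,d₁,d₂,d₃)` equals the convex hull of ten
explicit points (the points `Aᵢ, Bᵢ` depend on whether the corresponding pairwise sum
of degrees is `≥ n + 1` or `≤ n + 1`; at equality the two descriptions agree). -/
theorem kss_domain_Pn_three_divisors_ge (n d₁ d₂ d₃ : ℕ) (hn : 2 ≤ n)
    (hd₁ : 0 < d₁) (hd₂ : 0 < d₂) (hd₃ : 0 < d₃)
    (hd₁' : d₁ ≤ n + 1) (hd₂' : d₂ ≤ n + 1) (hd₃' : d₃ ≤ n + 1)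
    (hsum : n + 1 ≤ d₁ + d₂ + d₃) :
    {p : ℝ × ℝ × ℝ | 0 ≤ p.1 ∧ p.1 ≤ 1 ∧ 0 ≤ p.2.1 ∧ p.2.1 ≤ 1 ∧ 0 ≤ p.2.2 ∧ p.2.2 ≤ 1 ∧
      (d₁ : ℝ) * p.1 + (d₂ : ℝ) * p.2.1 + (d₃ : ℝ) * p.2.2 ≤ (n : ℝ) + 1 ∧
      0 ≤ ((d₁ : ℝ) - 1) / (d₁ : ℝ) - (n : ℝ) * p.1 / ((n : ℝ) + 1)
          + (d₂ : ℝ) * p.2.1 / ((d₁ : ℝ) * ((n : ℝ) + 1))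
          + (d₃ : ℝ) * p.2.2 / ((d₁ : ℝ) * ((n : ℝ) + 1)) ∧
      0 ≤ ((d₂ : ℝ) - 1) / (d₂ : ℝ) - (n : ℝ) * p.2.1 / ((n : ℝ) + 1)
          + (d₁ : ℝ) * p.1 / ((d₂ : ℝ) * ((n : ℝ) + 1))
          + (d₃ : ℝ) * p.2.2 / ((d₂ : ℝ) * ((n : ℝ) + 1)) ∧
      0 ≤ ((d₃ : ℝ) - 1) / (d₃ : ℝ) - (n : ℝ) * p.2.2 / ((n : ℝ) + 1)
          + (d₁ : ℝ) * p.1 / ((d₃ : ℝ) * ((n : ℝ) + 1))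
          + (d₂ : ℝ) * p.2.1 / ((d₃ : ℝ) * ((n : ℝ) + 1))} =
    convexHull ℝ
      {((0 : ℝ), (0 : ℝ), (0 : ℝ)),
       ((((n : ℝ) + 1) * ((d₁ : ℝ) - 1)) / ((n : ℝ) * (d₁ : ℝ)), 0, 0),
       (0, (((n : ℝ) + 1) * ((d₂ : ℝ) - 1)) / ((n : ℝ) * (d₂ : ℝ)), 0),
       (0, 0, (((n : ℝ) + 1) * ((d₃ : ℝ) - 1)) / ((n : ℝ) * (d₃ : ℝ))),
       -- A₁
       (if n + 1 ≤ d₂ + d₃ then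
          ((0 : ℝ), (1 : ℝ), ((n : ℝ) + 1 - (d₂ : ℝ)) / (d₃ : ℝ))
        else
          (0, ((d₃ : ℝ) - 1 + (n : ℝ) * ((d₂ : ℝ) - 1)) / (((n : ℝ) - 1) * (d₂ : ℝ)),
           ((d₂ : ℝ) - 1 + (n : ℝ) * ((d₃ : ℝ) - 1)) / (((n : ℝ) - 1) * (d₃ : ℝ)))),
       -- B₁
       (if n + 1 ≤ d₂ + d₃ then
          ((0 : ℝ), ((n : ℝ) + 1 - (d₃ : ℝ)) / (d₂ : ℝ), (1 : ℝ))
        else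
          (((n : ℝ) + 1 - ((d₂ : ℝ) + (d₃ : ℝ))) / (d₁ : ℝ), 1, 1)),
       -- A₂
       (if n + 1 ≤ d₁ + d₃ then
          ((1 : ℝ), (0 : ℝ), ((n : ℝ) + 1 - (d₁ : ℝ)) / (d₃ : ℝ))
        else
          (((d₃ : ℝ) - 1 + (n : ℝ) * ((d₁ : ℝ) - 1)) / (((n : ℝ) - 1) * (d₁ : ℝ)), 0,
           ((d₁ : ℝ) - 1 + (n : ℝ) * ((d₃ : ℝ) - 1)) / (((n : ℝ) - 1) * (d₃ : ℝ)))),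
       -- B₂
       (if n + 1 ≤ d₁ + d₃ then
          (((n : ℝ) + 1 - (d₃ : ℝ)) / (d₁ : ℝ), (0 : ℝ), (1 : ℝ))
        else
          (1, ((n : ℝ) + 1 - ((d₁ : ℝ) + (d₃ : ℝ))) / (d₂ : ℝ), 1)),
       -- A₃
       (if n + 1 ≤ d₁ + d₂ then
          ((1 : ℝ), ((n : ℝ) + 1 - (d₁ : ℝ)) / (d₂ : ℝ), (0 : ℝ))
        else
          (((d₂ : ℝ) - 1 + (n : ℝ) * ((d₁ : ℝ) - 1)) / (((n : ℝ) - 1) * (d₁ : ℝ)),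
           ((d₁ : ℝ) - 1 + (n : ℝ) * ((d₂ : ℝ) - 1)) / (((n : ℝ) - 1) * (d₂ : ℝ)), 0)),
       -- B₃
       (if n + 1 ≤ d₁ + d₂ then
          (((n : ℝ) + 1 - (d₂ : ℝ)) / (d₁ : ℝ), (1 : ℝ), (0 : ℝ))
        else
          (1, 1, ((n : ℝ) + 1 - ((d₁ : ℝ) + (d₂ : ℝ))) / (d₃ : ℝ)))} := by
  have hn' : (2 : ℝ) ≤ n := by exact_mod_cast hn
  have e₁ : (1 : ℝ) ≤ d₁ := by exact_mod_cast hd₁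
  have e₂ : (1 : ℝ) ≤ d₂ := by exact_mod_cast hd₂
  have e₃ : (1 : ℝ) ≤ d₃ := by exact_mod_cast hd₃
  have f₁ : (d₁ : ℝ) ≤ n + 1 := by exact_mod_cast hd₁'
  have f₂ : (d₂ : ℝ) ≤ n + 1 := by exact_mod_cast hd₂'
  have f₃ : (d₃ : ℝ) ≤ n + 1 := by exact_mod_cast hd₃'
  have hs : (n : ℝ) + 1 ≤ d₁ + d₂ + d₃ := by exact_mod_cast hsum
  have c₁₂ : n + 1 ≤ d₁ + d₂ ↔ (n : ℝ) + 1 ≤ d₁ + d₂ := by norm_cast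
  have c₁₃ : n + 1 ≤ d₁ + d₃ ↔ (n : ℝ) + 1 ≤ d₁ + d₃ := by norm_cast
  have c₂₃ : n + 1 ≤ d₂ + d₃ ↔ (n : ℝ) + 1 ≤ d₂ + d₃ := by norm_cast
  simp only [c₁₂, c₁₃, c₂₃]
  clear c₁₂ c₁₃ c₂₃ hsum hd₁' hd₂' hd₃' hn hd₁ hd₂ hd₃
  generalize (n : ℝ) = n at *
  generalize (d₁ : ℝ) = d₁ at *
  generalize (d₂ : ℝ) = d₂ at *
  generalize (d₃ : ℝ) = d₃ at *
  have hN : 0 < n + 1 := by linarith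
  have p₁ : 0 < d₁ := by linarith
  have p₂ : 0 < d₂ := by linarith
  have p₃ : 0 < d₃ := by linarith
  have hn1 : 0 < n - 1 := by linarith
  trans reducedPolytope n d₁ d₂ d₃
  · ext ⟨x, y, z⟩
    have t₁ := slack_nonneg_iff (u := x) (v := y) (w := z) (a := d₂) (b := d₃) hN p₁
    have t₂ := slack_nonneg_iff (u := y) (v := x) (w := z) (a := d₁) (b := d₃) hN p₂
    have t₃ := slack_nonneg_iff (u := z) (v := x) (w := y) (a := d₁) (b := d₂) hN p₃
    rw [show d₂ * y + d₁ * x + d₃ * z = d₁ * x + d₂ * y + d₃ * z by ring] at t₂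
    rw [show d₃ * z + d₁ * x + d₂ * y = d₁ * x + d₂ * y + d₃ * z by ring] at t₃
    simp only [reducedPolytope, Set.mem_ofPred_eq, t₁, t₂, t₃, mul_nonneg_iff_of_pos_left p₁,
      mul_nonneg_iff_of_pos_left p₂, mul_nonneg_iff_of_pos_left p₃]
    constructor
    · rintro ⟨h1, -, h2, -, h3, -, h4, h5, h6, h7⟩
      exact ⟨h1, h2, h3, by linarith, h5, h6, h7⟩
    · rintro ⟨h1, h2, h3, h4, h5, h6, h7⟩
      refine ⟨h1, ?_, h2, ?_, h3, ?_, by linarith, h5, h6, h7⟩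
      · exact (mul_le_iff_le_one_right p₁).1 (coord_le_of_slack_nonneg hN h4 h5)
      · exact (mul_le_iff_le_one_right p₂).1 (coord_le_of_slack_nonneg hN h4 h6)
      · exact (mul_le_iff_le_one_right p₃).1 (coord_le_of_slack_nonneg hN h4 h7)
  apply subset_antisymm
  · rw [← closure_convexHull_extremePoints (isCompact_reducedPolytope hN p₁ p₂ p₃)
      (convex_reducedPolytope n d₁ d₂ d₃)]
    refine closure_minimal (convexHull_mono ?_)
      (Set.Finite.isClosed_convexHull ℝ (Set.toFinite _))
    rintro ⟨x, y, z⟩ hp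
    obtain ⟨h1, h2, h3, h4, h5, h6, h7⟩ := hp.1
    simp only [Set.mem_insert_iff, Set.mem_singleton_iff]
    have hx : ∀ {u}, d₁ * x = u → x = u / d₁ := fun h => by rw [← h]; field_simp
    have hy : ∀ {u}, d₂ * y = u → y = u / d₂ := fun h => by rw [← h]; field_simp
    have hz : ∀ {u}, d₃ * z = u → z = u / d₃ := fun h => by rw [← h]; field_simp
    have hdiv : ∀ {c t u d : ℝ}, 0 < c → 0 < d → c * (d * t) = u → t = u / (c * d) :=
      fun hc hd h => by rw [← h]; field_simp
    have hnpos : 0 < n := by linarith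
    dsimp only at h1 h2 h3 h4 h5 h6 h7
    by_cases hfull : d₁ * x + d₂ * y + d₃ * z = n + 1
    · rcases vertex_classification_of_sum_eq hn' f₁ f₂ f₃ h1 h2 h3 h4 h5 h6 h7
        (direction_eq_zero_of_mem_extremePoints p₁ p₂ p₃ hp) hfull with
        ⟨h, a, b, c⟩ | ⟨h, a, b, c⟩ | ⟨h, a, b, c⟩ | ⟨h, a, b, c⟩ | ⟨h, a, b, c⟩ |
        ⟨h, a, b, c⟩ | ⟨h, a, b, c⟩ | ⟨h, a, b, c⟩ | ⟨h, a, b, c⟩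
      · iterate 4 right
        left
        rw [if_pos h, hx a, hy b, hz c, zero_div, div_self p₂.ne']
      · iterate 5 right
        left
        rw [if_pos h, hx a, hy b, hz c, zero_div, div_self p₃.ne']
      · iterate 6 right
        left
        rw [if_pos h, hx a, hy b, hz c, zero_div, div_self p₁.ne']
      · iterate 7 right
        left
        rw [if_pos h, hx a, hy b, hz c, zero_div, div_self p₃.ne']
      · iterate 8 right
        left
        rw [if_pos h, hx a, hy b, hz c, zero_div, div_self p₁.ne']
      · iterate 9 right
        rw [if_pos h, hx a, hy b, hz c, zero_div, div_self p₂.ne']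
      · iterate 5 right
        left
        split_ifs with h'
        · obtain rfl : n = d₂ + d₃ - 1 := by linarith
          rw [hx a, hy b, hz c, div_self p₂.ne', div_self p₃.ne', sub_add_cancel, sub_self,
            add_sub_cancel_right, zero_div, div_self p₂.ne']
        · rw [hx a, hy b, hz c, div_self p₂.ne', div_self p₃.ne']
      · iterate 7 right
        left
        split_ifs with h'
        · obtain rfl : n = d₁ + d₃ - 1 := by linarith
          rw [hx a, hy b, hz c, div_self p₁.ne', div_self p₃.ne', sub_add_cancel, sub_self,
            add_sub_cancel_right, zero_div, div_self p₁.ne']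
        · rw [hx a, hy b, hz c, div_self p₁.ne', div_self p₃.ne']
      · iterate 9 right
        split_ifs with h'
        · obtain rfl : n = d₁ + d₂ - 1 := by linarith
          rw [hx a, hy b, hz c, div_self p₁.ne', div_self p₂.ne', sub_add_cancel, sub_self,
            add_sub_cancel_right, zero_div, div_self p₁.ne']
        · rw [hx a, hy b, hz c, div_self p₁.ne', div_self p₂.ne']
    · rcases vertex_classification_of_sum_ne hn' e₁ e₂ e₃ hs h1 h2 h3 h4 h5 h6 h7
        (direction_eq_zero_of_mem_extremePoints p₁ p₂ p₃ hp) hfull with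
        ⟨a, b, c⟩ | ⟨a, b, c⟩ | ⟨a, b, c⟩ | ⟨a, b, c⟩ |
        ⟨h, a, b, c⟩ | ⟨h, a, b, c⟩ | ⟨h, a, b, c⟩
      · left
        rw [hx a, hy b, hz c]
        simp
      · right; left
        rw [hdiv hnpos p₁ a, hy b, hz c]
        simp
      · iterate 2 right
        left
        rw [hx a, hdiv hnpos p₂ b, hz c]
        simp
      · iterate 3 right
        left
        rw [hx a, hy b, hdiv hnpos p₃ c]
        simp
      · iterate 4 right
        left
        rw [if_neg h.not_ge, hx a, hdiv hn1 p₂ b, hdiv hn1 p₃ c, zero_div]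
      · iterate 6 right
        left
        rw [if_neg h.not_ge, hdiv hn1 p₁ a, hy b, hdiv hn1 p₃ c, zero_div]
      · iterate 8 right
        left
        rw [if_neg h.not_ge, hdiv hn1 p₁ a, hdiv hn1 p₂ b, hz c, zero_div]
  · refine convexHull_min ?_ (convex_reducedPolytope n d₁ d₂ d₃)
    have of_div : ∀ {u₁ u₂ u₃ : ℝ} {q : ℝ × ℝ × ℝ},
        (u₁ / d₁, u₂ / d₂, u₃ / d₃) ∈ reducedPolytope n d₁ d₂ d₃ →
        q.1 = u₁ / d₁ → q.2.1 = u₂ / d₂ → q.2.2 = u₃ / d₃ → q ∈ reducedPolytope n d₁ d₂ d₃ := by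
      rintro u₁ u₂ u₃ ⟨x, y, z⟩ h rfl rfl rfl
      exact h
    have z₁ := (zero_div d₁).symm
    have z₂ := (zero_div d₂).symm
    have z₃ := (zero_div d₃).symm
    have o₁ := (div_self p₁.ne').symm
    have o₂ := (div_self p₂.ne').symm
    have o₃ := (div_self p₃.ne').symm
    have g₁ := mul_nonneg hN.le (sub_nonneg.2 e₁)
    have g₂ := mul_nonneg hN.le (sub_nonneg.2 e₂)
    have g₃ := mul_nonneg hN.le (sub_nonneg.2 e₃)
    rintro q (rfl | rfl | rfl | rfl | rfl | rfl | rfl | rfl | rfl | rfl)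
    · refine of_div (div_mem_reducedPolytope p₁ p₂ p₃ (le_refl 0) (le_refl 0) (le_refl 0)
        ?_ ?_ ?_ ?_) z₁ z₂ z₃ <;> linarith
    · obtain ⟨l1, l2, l3⟩ := axis_vertex hn' e₁ f₁
      refine of_div (div_mem_reducedPolytope p₁ p₂ p₃ l1 le_rfl le_rfl
        ?_ ?_ ?_ ?_) (div_div _ _ _).symm z₂ z₃ <;> linarith
    · obtain ⟨l1, l2, l3⟩ := axis_vertex hn' e₂ f₂
      refine of_div (div_mem_reducedPolytope p₁ p₂ p₃ le_rfl l1 le_rfl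
        ?_ ?_ ?_ ?_) z₁ (div_div _ _ _).symm z₃ <;> linarith
    · obtain ⟨l1, l2, l3⟩ := axis_vertex hn' e₃ f₃
      refine of_div (div_mem_reducedPolytope p₁ p₂ p₃ le_rfl le_rfl l1
        ?_ ?_ ?_ ?_) z₁ z₂ (div_div _ _ _).symm <;> linarith
    · split_ifs with h
      · refine of_div (div_mem_reducedPolytope_of_sum_eq hN p₁ p₂ p₃ ?_ ?_ ?_ ?_ ?_ ?_ ?_)
          z₁ o₂ rfl <;> linarith
      · obtain ⟨l1, l2, l3, l4, l5⟩ := plane_vertex hn' e₂ e₃ (not_le.1 h).le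
        refine of_div (div_mem_reducedPolytope p₁ p₂ p₃ le_rfl l1 l2 ?_ ?_ ?_ ?_)
          z₁ (div_div _ _ _).symm (div_div _ _ _).symm <;> linarith
    · split_ifs with h
      · refine of_div (div_mem_reducedPolytope_of_sum_eq hN p₁ p₂ p₃ ?_ ?_ ?_ ?_ ?_ ?_ ?_)
          z₁ rfl o₃ <;> linarith
      · have h := (not_le.1 h).le
        refine of_div (div_mem_reducedPolytope_of_sum_eq hN p₁ p₂ p₃ ?_ ?_ ?_ ?_ ?_ ?_ ?_)
          rfl o₂ o₃ <;> linarith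
    · split_ifs with h
      · refine of_div (div_mem_reducedPolytope_of_sum_eq hN p₁ p₂ p₃ ?_ ?_ ?_ ?_ ?_ ?_ ?_)
          o₁ z₂ rfl <;> linarith
      · obtain ⟨l1, l2, l3, l4, l5⟩ := plane_vertex hn' e₁ e₃ (not_le.1 h).le
        refine of_div (div_mem_reducedPolytope p₁ p₂ p₃ l1 le_rfl l2 ?_ ?_ ?_ ?_)
          (div_div _ _ _).symm z₂ (div_div _ _ _).symm <;> linarith
    · split_ifs with h
      · refine of_div (div_mem_reducedPolytope_of_sum_eq hN p₁ p₂ p₃ ?_ ?_ ?_ ?_ ?_ ?_ ?_)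
          rfl z₂ o₃ <;> linarith
      · have h := (not_le.1 h).le
        refine of_div (div_mem_reducedPolytope_of_sum_eq hN p₁ p₂ p₃ ?_ ?_ ?_ ?_ ?_ ?_ ?_)
          o₁ rfl o₃ <;> linarith
    · split_ifs with h
      · refine of_div (div_mem_reducedPolytope_of_sum_eq hN p₁ p₂ p₃ ?_ ?_ ?_ ?_ ?_ ?_ ?_)
          o₁ rfl z₃ <;> linarith
      · obtain ⟨l1, l2, l3, l4, l5⟩ := plane_vertex hn' e₁ e₂ (not_le.1 h).le
        refine of_div (div_mem_reducedPolytope p₁ p₂ p₃ l1 l2 le_rfl ?_ ?_ ?_ ?_)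
          (div_div _ _ _).symm (div_div _ _ _).symm z₃ <;> linarith
    · split_ifs with h
      · refine of_div (div_mem_reducedPolytope_of_sum_eq hN p₁ p₂ p₃ ?_ ?_ ?_ ?_ ?_ ?_ ?_)
          rfl o₂ z₃ <;> linarith
      · have h := (not_le.1 h).le
        refine of_div (div_mem_reducedPolytope_of_sum_eq hN p₁ p₂ p₃ ?_ ?_ ?_ ?_ ?_ ?_ ?_)
          o₁ o₂ rfl <;> linarith
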